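/- arXiv:2002.01980 — 7 statements merged into one kernel-verified Lean document; each statement's English description precedes it below -/
import Mathlib

section
/- Let f : ℝ^n → ℝ be strictly convex and g_1,…,g_K : ℝ^n → ℝ be convex. Suppose x̂ ∈ ℝ^n and λ̂ ∈ ℝ^K satisfy the KKT conditions for the problem min f(x) subject to g_i(x) ≤ 0 for all i, namely: g_i(x̂) ≤ 0 for all i, λ̂ ≥ 0 componentwise, Σ_i λ̂_i g_i(x̂) = 0, and x̂ minimizes the Lagrangian x ↦ f(x) + Σ_i λ̂_i g_i(x) over ℝ^n. Let p : ℝ → ℝ be a differentiable, increasing, convex function whose derivative satisfies p'(s) > Σ_i λ̂_i for all s ≥ 0. Then (x̂, 0) is a minimizer of the problem min_{x, s≥0} f(x) + p(s) subject to g_i(x) ≤ s for all i, and every minimizer (x̃, s̃) of this problem satisfies x̃ = x̂ and s̃ = 0. -/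
/-- A differentiable function whose derivative exceeds `c` on `[0, ∞)` grows faster than `c * s`. -/
lemma mul_lt_sub_of_lt_deriv {p : ℝ → ℝ} {c s : ℝ} (hp : Differentiable ℝ p)
    (hc : ∀ t, 0 ≤ t → c < deriv p t) (hs : 0 < s) : c * s < p s - p 0 := by
  obtain ⟨t, ht, hslope⟩ :=
    exists_deriv_eq_slope p hs hp.continuous.continuousOn hp.differentiableOn
  have hct := hc t ht.1.le
  rwa [hslope, sub_zero, lt_div_iff₀ hs] at hct

/-- Weak duality with slack: a Lagrangian minimizer satisfying complementary slackness is optimal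
up to `(∑ i, lam i) * s` among points violating the constraints by at most `s`. -/
lemma le_add_sum_mul_of_lagrangian_min {E ι : Type*} [Fintype ι] {f : E → ℝ} {g : ι → E → ℝ}
    {xh : E} {lam : ι → ℝ} (hlam : ∀ i, 0 ≤ lam i) (hcs : ∑ i, lam i * g i xh = 0)
    (hlagr : ∀ x, f xh + ∑ i, lam i * g i xh ≤ f x + ∑ i, lam i * g i x)
    {x : E} {s : ℝ} (hx : ∀ i, g i x ≤ s) : f xh ≤ f x + (∑ i, lam i) * s := by
  have hsum : ∑ i, lam i * g i x ≤ (∑ i, lam i) * s := by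
    rw [Finset.sum_mul]
    exact Finset.sum_le_sum fun i _ => mul_le_mul_of_nonneg_left (hx i) (hlam i)
  linarith [hlagr x]

/-- Exact penalty for the slack-relaxed convex program (Proposition 2).
If `(xh, lam)` satisfies the KKT conditions for `min f(x) s.t. g i x ≤ 0`,
`f` strictly convex, `g i` convex, and `p` is a differentiable increasing convex penalty
with `p' s > ∑ i, lam i` for all `s ≥ 0`, then `(xh, 0)` minimizes
`f x + p s` over `{(x,s) : s ≥ 0, g i x ≤ s ∀ i}` and every minimizer equals `(xh, 0)`. -/
theorem stmt_0 {n K : ℕ} (f : (Fin n → ℝ) → ℝ) (g : Fin K → (Fin n → ℝ) → ℝ)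
    (hf : StrictConvexOn ℝ Set.univ f) (hg : ∀ i, ConvexOn ℝ Set.univ (g i))
    (xh : Fin n → ℝ) (lam : Fin K → ℝ)
    (hfeas : ∀ i, g i xh ≤ 0) (hlam : ∀ i, 0 ≤ lam i)
    (hcs : ∑ i, lam i * g i xh = 0)
    (hlagr : ∀ x : Fin n → ℝ, f xh + ∑ i, lam i * g i xh ≤ f x + ∑ i, lam i * g i x)
    (p : ℝ → ℝ) (hpdiff : Differentiable ℝ p) (hpmono : Monotone p)
    (hpconv : ConvexOn ℝ Set.univ p)
    (hpderiv : ∀ s : ℝ, 0 ≤ s → (∑ i, lam i) < deriv p s) :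
    (∀ (x : Fin n → ℝ) (s : ℝ), 0 ≤ s → (∀ i, g i x ≤ s) →
        f xh + p 0 ≤ f x + p s) ∧
    (∀ (xt : Fin n → ℝ) (st : ℝ), 0 ≤ st → (∀ i, g i xt ≤ st) →
        (∀ (x : Fin n → ℝ) (s : ℝ), 0 ≤ s → (∀ i, g i x ≤ s) →
          f xt + p st ≤ f x + p s) →
        xt = xh ∧ st = 0) := by
  have hdual : ∀ (x : Fin n → ℝ) (s : ℝ), (∀ i, g i x ≤ s) → f xh ≤ f x + (∑ i, lam i) * s :=
    fun x s hx => le_add_sum_mul_of_lagrangian_min hlam hcs hlagr hx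
  refine ⟨fun x s hs hx => ?_, fun xt st hst hxt hmin => ?_⟩
  · have hd := hdual x s hx
    rcases hs.eq_or_lt with rfl | hs
    · linarith
    · linarith [mul_lt_sub_of_lt_deriv hpdiff hpderiv hs]
  · have hle := hmin xh 0 le_rfl hfeas
    rcases hst.eq_or_lt with rfl | hst
    · refine ⟨?_, rfl⟩
      have hfeas_convex : Convex ℝ {x | ∀ i, g i x ≤ 0} := by
        simpa [Set.ofPred_forall] using convex_iInter fun i => (hg i).convex_le 0
      refine (hf.subset (Set.subset_univ _) hfeas_convex).eq_of_isMinOn ?_ ?_ hxt hfeas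
      · intro x hx
        have hd := hdual x 0 hx
        simp only [Set.mem_ofPred_eq]
        linarith
      · intro x hx
        have hd := hdual x 0 hx
        simp only [Set.mem_ofPred_eq]
        linarith
    · linarith [hdual xt st hxt, mul_lt_sub_of_lt_deriv hpdiff hpderiv hst]
end

section
/- Let H be a symmetric positive definite n×n real matrix, c ∈ ℝ^n, and let C₁ ∈ ℝ^{m₁×n}, d₁ ∈ ℝ^{m₁}, C₂ ∈ ℝ^{m₂×n}, d₂ ∈ ℝ^{m₂}. Define F(x) = ½ xᵀHx + cᵀx. Suppose (x̂, λ̂₁, λ̂₂) satisfies the KKT conditions for min F(x) subject to C₁x ≤ d₁ and C₂x ≤ d₂: C₁x̂ ≤ d₁, C₂x̂ ≤ d₂, λ̂₁ ≥ 0, λ̂₂ ≥ 0, λ̂₁ᵀ(C₁x̂ − d₁) = 0, λ̂₂ᵀ(C₂x̂ − d₂) = 0, and Hx̂ + c + C₁ᵀλ̂₁ + C₂ᵀλ̂₂ = 0. Let ν > 0 and η ≥ 1ᵀλ̂₂. Then (x̂, 0) is a minimizer of the penalized problem min_{x, s≥0} F(x) + ν s² + η s subject to C₁x ≤ d₁ and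 C₂x ≤ d₂ + s·1, and every minimizer (x̃, s̃) of the penalized problem satisfies x̃ = x̂ and s̃ = 0. -/
open Matrix

/-- Second-order expansion of a quadratic function with symmetric Hessian. -/
lemma quadratic_eq_add_gradient {ι : Type*} [Fintype ι] {H : Matrix ι ι ℝ} (hH : H.IsSymm)
    (c x y : ι → ℝ) :
    (1 / 2) * (x ⬝ᵥ H *ᵥ x) + c ⬝ᵥ x =
      (1 / 2) * (y ⬝ᵥ H *ᵥ y) + c ⬝ᵥ y + (H *ᵥ y + c) ⬝ᵥ (x - y) +
        (1 / 2) * ((x - y) ⬝ᵥ H *ᵥ (x - y)) := by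
  have hsymm : y ⬝ᵥ H *ᵥ x = x ⬝ᵥ H *ᵥ y := by
    rw [dotProduct_mulVec, ← mulVec_transpose, hH.eq, dotProduct_comm]
  simp only [mulVec_sub, dotProduct_sub, sub_dotProduct, add_dotProduct, hsymm,
    dotProduct_comm (H *ᵥ y)]
  ring

/-- A nonnegative multiplier satisfying complementary slackness at `y` bounds the multiplier
term along any direction to a point `x` whose constraint violation is at most `s`. -/
lemma transpose_mulVec_dotProduct_sub_le {ι κ : Type*} [Fintype ι] [Fintype κ]
    {C : Matrix κ ι ℝ} {d lam : κ → ℝ} {x y : ι → ℝ} {s : ℝ} (hlam : ∀ i, 0 ≤ lam i)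
    (hcs : lam ⬝ᵥ (C *ᵥ y - d) = 0) (hx : ∀ i, (C *ᵥ x) i ≤ d i + s) :
    (Cᵀ *ᵥ lam) ⬝ᵥ (x - y) ≤ s * ∑ i, lam i := by
  have hbound : lam ⬝ᵥ (C *ᵥ x - d) ≤ s * ∑ i, lam i := by
    rw [Finset.mul_sum]
    refine Finset.sum_le_sum fun i _ => ?_
    rw [mul_comm s]
    exact mul_le_mul_of_nonneg_left (by simpa [add_comm s] using hx i) (hlam i)
  have hsplit : (Cᵀ *ᵥ lam) ⬝ᵥ (x - y) = lam ⬝ᵥ (C *ᵥ x - d) - lam ⬝ᵥ (C *ᵥ y - d) := by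
    rw [mulVec_transpose, ← dotProduct_mulVec, ← dotProduct_sub, mulVec_sub,
      sub_sub_sub_cancel_right]
  linarith

/-- Exact linear–quadratic penalty for the dispatch QP.
If `(xh, lam1, lam2)` satisfies the KKT conditions of
`min ½xᵀHx + cᵀx s.t. C₁x ≤ d₁, C₂x ≤ d₂` with `H` symmetric positive definite,
`ν > 0` and `η ≥ 1ᵀlam2`, then `(xh, 0)` minimizes the penalized problem
`min F(x) + ν s² + η s s.t. s ≥ 0, C₁x ≤ d₁, C₂x ≤ d₂ + s·1`,
and every minimizer of the penalized problem equals `(xh, 0)`. -/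
theorem stmt_2 {n m₁ m₂ : ℕ}
    (H : Matrix (Fin n) (Fin n) ℝ) (hH : H.PosDef)
    (c : Fin n → ℝ)
    (C1 : Matrix (Fin m₁) (Fin n) ℝ) (d1 : Fin m₁ → ℝ)
    (C2 : Matrix (Fin m₂) (Fin n) ℝ) (d2 : Fin m₂ → ℝ)
    (F : (Fin n → ℝ) → ℝ)
    (hF : ∀ x : Fin n → ℝ, F x = (1/2) * (x ⬝ᵥ H *ᵥ x) + c ⬝ᵥ x)
    (xh : Fin n → ℝ) (lam1 : Fin m₁ → ℝ) (lam2 : Fin m₂ → ℝ)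
    (hfeas1 : ∀ i, (C1 *ᵥ xh) i ≤ d1 i) (hfeas2 : ∀ i, (C2 *ᵥ xh) i ≤ d2 i)
    (hlam1 : ∀ i, 0 ≤ lam1 i) (hlam2 : ∀ i, 0 ≤ lam2 i)
    (hcs1 : lam1 ⬝ᵥ (C1 *ᵥ xh - d1) = 0) (hcs2 : lam2 ⬝ᵥ (C2 *ᵥ xh - d2) = 0)
    (hstat : H *ᵥ xh + c + C1ᵀ *ᵥ lam1 + C2ᵀ *ᵥ lam2 = 0)
    (ν η : ℝ) (hν : 0 < ν) (hη : ∑ i, lam2 i ≤ η) :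
    (∀ (x : Fin n → ℝ) (s : ℝ), 0 ≤ s →
        (∀ i, (C1 *ᵥ x) i ≤ d1 i) → (∀ i, (C2 *ᵥ x) i ≤ d2 i + s) →
        F xh + ν * 0 ^ 2 + η * 0 ≤ F x + ν * s ^ 2 + η * s) ∧
    (∀ (xt : Fin n → ℝ) (st : ℝ), 0 ≤ st →
        (∀ i, (C1 *ᵥ xt) i ≤ d1 i) → (∀ i, (C2 *ᵥ xt) i ≤ d2 i + st) →
        (∀ (x : Fin n → ℝ) (s : ℝ), 0 ≤ s →
          (∀ i, (C1 *ᵥ x) i ≤ d1 i) → (∀ i, (C2 *ᵥ x) i ≤ d2 i + s) →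
          F xt + ν * st ^ 2 + η * st ≤ F x + ν * s ^ 2 + η * s) →
        xt = xh ∧ st = 0) := by
  have hgrowth : ∀ (x : Fin n → ℝ) (s : ℝ), 0 ≤ s →
      (∀ i, (C1 *ᵥ x) i ≤ d1 i) → (∀ i, (C2 *ᵥ x) i ≤ d2 i + s) →
      F xh + (1 / 2) * ((x - xh) ⬝ᵥ H *ᵥ (x - xh)) + ν * s ^ 2 ≤
        F x + ν * s ^ 2 + η * s := by
    intro x s hs hx1 hx2
    have hexp := quadratic_eq_add_gradient (H := H) (by simpa using hH.isHermitian) c x xh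
    have hmul1 := transpose_mulVec_dotProduct_sub_le (s := 0) hlam1 hcs1 (by simpa using hx1)
    have hmul2 := transpose_mulVec_dotProduct_sub_le hlam2 hcs2 hx2
    have hgrad := congrArg (· ⬝ᵥ (x - xh)) hstat
    simp only [add_dotProduct, zero_dotProduct] at hgrad hexp
    have hpen := mul_le_mul_of_nonneg_left hη hs
    rw [hF, hF]
    linarith
  have hpos : ∀ q : Fin n → ℝ, 0 ≤ q ⬝ᵥ H *ᵥ q := fun q => by
    simpa using hH.posSemidef.dotProduct_mulVec_nonneg q
  refine ⟨fun x s hs hx1 hx2 => ?_, fun xt st hst hx1 hx2 hmin => ?_⟩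
  · have hg := hgrowth x s hs hx1 hx2
    have hq := hpos (x - xh)
    have hsq : 0 ≤ ν * s ^ 2 := by positivity
    linarith
  · have hg := hgrowth xt st hst hx1 hx2
    have hm := hmin xh 0 le_rfl hfeas1 (by simpa using hfeas2)
    have hq := hpos (xt - xh)
    have hsq : 0 ≤ ν * st ^ 2 := by positivity
    constructor
    · by_contra hne
      have hlt := hH.dotProduct_mulVec_pos (sub_ne_zero.mpr hne)
      rw [star_trivial] at hlt
      linarith
    · have hzero : ν * st ^ 2 = 0 := by linarith
      simpa [hν.ne'] using hzero
end

section
/- Let Γ be an invertible N×N real matrix and let r, x : Fin N → ℝ with r(n) > 0 and r(n)² + x(n)² > 0 for all n. Define the diagonal matrices D_r = diag(r), D_x = diag(x), and set R := Γ⁻¹ D_r Γ⁻ᵀ, X := Γ⁻¹ D_x Γ⁻ᵀ, and N := 2 Γᵀ D_r (D_r² + D_x²)⁻¹ Γ. Then R·N·R + X·N·X = 2R. -/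
open Matrix

/-- Sandwiching `Γᵀ * B * Γ` between two copies of `Γ⁻¹ * A * Γ⁻ᵀ` cancels the inner factors. -/
lemma Matrix.inv_congr_mul_congr_mul_inv_congr {ι K : Type*} [Fintype ι] [DecidableEq ι]
    [CommRing K] {Γ : Matrix ι ι K} (hΓ : IsUnit Γ.det) (A B : Matrix ι ι K) :
    (Γ⁻¹ * A * (Γ⁻¹)ᵀ) * (Γᵀ * B * Γ) * (Γ⁻¹ * A * (Γ⁻¹)ᵀ) =
      Γ⁻¹ * (A * B * A) * (Γ⁻¹)ᵀ := by
  have hT : (Γ⁻¹)ᵀ * Γᵀ = 1 := by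
    rw [← Matrix.transpose_mul, Matrix.mul_nonsing_inv Γ hΓ, Matrix.transpose_one]
  calc (Γ⁻¹ * A * (Γ⁻¹)ᵀ) * (Γᵀ * B * Γ) * (Γ⁻¹ * A * (Γ⁻¹)ᵀ)
      = Γ⁻¹ * A * ((Γ⁻¹)ᵀ * Γᵀ) * B * (Γ * Γ⁻¹) * A * (Γ⁻¹)ᵀ := by
        simp only [Matrix.mul_assoc]
    _ = Γ⁻¹ * (A * B * A) * (Γ⁻¹)ᵀ := by
        rw [hT, Matrix.mul_nonsing_inv Γ hΓ]
        simp only [Matrix.mul_assoc, Matrix.one_mul]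

/-- The diagonal case of the identity, with `Γ = 1`. -/
lemma Matrix.diagonal_conductance_identity {ι K : Type*} [Fintype ι] [DecidableEq ι]
    [Field K] (r x : ι → K) (hrx : ∀ i, r i ^ 2 + x i ^ 2 ≠ 0) :
    diagonal r * (diagonal r * (diagonal r ^ 2 + diagonal x ^ 2)⁻¹) * diagonal r +
      diagonal x * (diagonal r * (diagonal r ^ 2 + diagonal x ^ 2)⁻¹) * diagonal x =
        diagonal r := by
  have hinv : (diagonal r ^ 2 + diagonal x ^ 2)⁻¹ =
      diagonal fun i => (r i ^ 2 + x i ^ 2)⁻¹ := by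
    apply Matrix.inv_eq_right_inv
    rw [Matrix.diagonal_pow, Matrix.diagonal_pow, Matrix.diagonal_add,
      Matrix.diagonal_mul_diagonal, ← Matrix.diagonal_one]
    congr 1
    funext i
    exact mul_inv_cancel₀ (hrx i)
  rw [hinv]
  simp only [Matrix.diagonal_mul_diagonal, Matrix.diagonal_add]
  congr 1
  funext i
  have := hrx i
  field_simp

/-- with `R = Γ⁻¹ D_r Γ⁻ᵀ`, `X = Γ⁻¹ D_x Γ⁻ᵀ` and
`N = 2 Γᵀ D_r (D_r² + D_x²)⁻¹ Γ`, one has `R·N·R + X·N·X = 2R`. -/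
theorem stmt_8 {n : ℕ} (Γ : Matrix (Fin n) (Fin n) ℝ) (hΓ : IsUnit Γ.det)
    (r x : Fin n → ℝ) (hr : ∀ i, 0 < r i) (hrx : ∀ i, 0 < r i ^ 2 + x i ^ 2) :
    let Dr := Matrix.diagonal r
    let Dx := Matrix.diagonal x
    let R := Γ⁻¹ * Dr * (Γ⁻¹)ᵀ
    let X := Γ⁻¹ * Dx * (Γ⁻¹)ᵀ
    let Nm := (2 : ℝ) • (Γᵀ * Dr * (Dr ^ 2 + Dx ^ 2)⁻¹ * Γ)
    R * Nm * R + X * Nm * X = (2 : ℝ) • R := by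
  intro Dr Dx R X Nm
  have hNm : Nm = (2 : ℝ) • (Γᵀ * (Dr * (Dr ^ 2 + Dx ^ 2)⁻¹) * Γ) := by
    simp only [Nm, Matrix.mul_assoc]
  have hdiag := Matrix.diagonal_conductance_identity r x fun i => (hrx i).ne'
  rw [hNm]
  simp only [Matrix.mul_smul, Matrix.smul_mul, R, X]
  rw [Matrix.inv_congr_mul_congr_mul_inv_congr hΓ, Matrix.inv_congr_mul_congr_mul_inv_congr hΓ,
    ← smul_add, ← Matrix.add_mul, ← Matrix.mul_add, hdiag]
end

section
/- Let Γ be an invertible N×N real matrix and let r, x : Fin N → ℝ with r(n) > 0 and r(n)² + x(n)² > 0 for all n. Define the diagonal matrices D_r = diag(r), D_x = diag(x), and set R := Γ⁻¹ D_r Γ⁻ᵀ, X := Γ⁻¹ D_x Γ⁻ᵀ, and N := 2 Γᵀ D_r (D_r² + D_x²)⁻¹ Γ. Then R·N·X = X·N·R, i.e., R·N·X − X·N·R = 0. -/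
open Matrix

/-- Congruence factors cancel in the product of `Γ⁻¹ A Γ⁻ᵀ`, `Γᵀ B Γ` and `Γ⁻¹ C Γ⁻ᵀ`. -/
theorem Matrix.congr_mul_congr_mul_congr {ι K : Type*} [Fintype ι] [DecidableEq ι] [CommRing K]
    {Γ : Matrix ι ι K} (hΓ : IsUnit Γ.det) (A B C : Matrix ι ι K) :
    (Γ⁻¹ * A * (Γ⁻¹)ᵀ) * (Γᵀ * B * Γ) * (Γ⁻¹ * C * (Γ⁻¹)ᵀ) =
      Γ⁻¹ * (A * B * C) * (Γ⁻¹)ᵀ := by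
  have hT : (Γ⁻¹)ᵀ * Γᵀ = 1 := by
    rw [← transpose_mul, mul_nonsing_inv Γ hΓ, transpose_one]
  calc _ = Γ⁻¹ * A * ((Γ⁻¹)ᵀ * Γᵀ) * B * (Γ * Γ⁻¹) * C * (Γ⁻¹)ᵀ := by noncomm_ring
    _ = _ := by rw [hT, mul_nonsing_inv Γ hΓ]; noncomm_ring

/-- with `R = Γ⁻¹ D_r Γ⁻ᵀ`, `X = Γ⁻¹ D_x Γ⁻ᵀ` and
`N = 2 Γᵀ D_r (D_r² + D_x²)⁻¹ Γ`, one has `R·N·X = X·N·R`, i.e. `R·N·X − X·N·R = 0`. -/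
theorem stmt_9 {n : ℕ} (Γ : Matrix (Fin n) (Fin n) ℝ) (hΓ : IsUnit Γ.det)
    (r x : Fin n → ℝ) (hr : ∀ i, 0 < r i) (hrx : ∀ i, 0 < r i ^ 2 + x i ^ 2) :
    let Dr := Matrix.diagonal r
    let Dx := Matrix.diagonal x
    let R := Γ⁻¹ * Dr * (Γ⁻¹)ᵀ
    let X := Γ⁻¹ * Dx * (Γ⁻¹)ᵀ
    let Nm := (2 : ℝ) • (Γᵀ * Dr * (Dr ^ 2 + Dx ^ 2)⁻¹ * Γ)
    R * Nm * X = X * Nm * R ∧ R * Nm * X - X * Nm * R = 0 := by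
  intro Dr Dx R X Nm
  have h : R * Nm * X = X * Nm * R := by
    simp only [R, X, Nm, Matrix.mul_smul, Matrix.smul_mul]
    rw [Matrix.mul_assoc Γᵀ Dr, congr_mul_congr_mul_congr hΓ, congr_mul_congr_mul_congr hΓ]
    simp only [Dr, Dx, diagonal_pow, diagonal_add, inv_diagonal, diagonal_mul_diagonal]
    congr 4
    ext i
    ring
  exact ⟨h, sub_eq_zero.mpr h⟩
end

section
/- Let Γ be an invertible N×N real matrix and let r, x : Fin N → ℝ with r(n) > 0 and r(n)² + x(n)² > 0 for all n. Define D_r = diag(r), D_x = diag(x), R := Γ⁻¹ D_r Γ⁻ᵀ, X := Γ⁻¹ D_x Γ⁻ᵀ, N := 2 Γᵀ D_r (D_r² + D_x²)⁻¹ Γ, the 2N×2N block matrices J := [[R, X], [X, −R]] and Ñ := [[N, 0], [0, N]]. Then Jᵀ Ñ J = [[2R, 0], [0, 2R]]; consequently, for all p, q ∈ ℝ^N, the second-order loss approximation satisfies ½ [p; q]ᵀ Jᵀ Ñ J [p; q] = pᵀ R p + qᵀ R q. -/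
open Matrix

/-- The congruence products `Γ⁻¹ A Γ⁻ᵀ` multiply through a middle factor `Γᵀ B Γ`. -/
theorem congr_inv_mul_congr_mul_congr_inv {m α : Type*} [Fintype m] [DecidableEq m] [CommRing α]
    {Γ : Matrix m m α} (hΓ : IsUnit Γ.det) (A B C : Matrix m m α) :
    Γ⁻¹ * A * (Γ⁻¹)ᵀ * (Γᵀ * B * Γ) * (Γ⁻¹ * C * (Γ⁻¹)ᵀ) = Γ⁻¹ * (A * B * C) * (Γ⁻¹)ᵀ := by
  have hT : (Γ⁻¹)ᵀ * Γᵀ = 1 := by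
    rw [← transpose_mul, mul_nonsing_inv Γ hΓ, transpose_one]
  calc Γ⁻¹ * A * (Γ⁻¹)ᵀ * (Γᵀ * B * Γ) * (Γ⁻¹ * C * (Γ⁻¹)ᵀ)
      = Γ⁻¹ * A * ((Γ⁻¹)ᵀ * Γᵀ) * B * (Γ * Γ⁻¹) * C * (Γ⁻¹)ᵀ := by
        simp only [Matrix.mul_assoc]
    _ = Γ⁻¹ * (A * B * C) * (Γ⁻¹)ᵀ := by
        rw [hT, mul_nonsing_inv Γ hΓ]
        simp only [Matrix.mul_assoc, Matrix.one_mul]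

theorem transpose_congr_diagonal {m α : Type*} [Fintype m] [DecidableEq m] [CommRing α]
    (P : Matrix m m α) (d : m → α) : (P * diagonal d * Pᵀ)ᵀ = P * diagonal d * Pᵀ := by
  simp only [transpose_mul, transpose_transpose, diagonal_transpose, Matrix.mul_assoc]

theorem inv_diagonal_sq_add_sq {m K : Type*} [Fintype m] [DecidableEq m] [Field K]
    (r x : m → K) (h : ∀ i, r i ^ 2 + x i ^ 2 ≠ 0) :
    (diagonal r ^ 2 + diagonal x ^ 2)⁻¹ = diagonal fun i => (r i ^ 2 + x i ^ 2)⁻¹ := by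
  refine inv_eq_right_inv ?_
  rw [diagonal_pow, diagonal_pow, diagonal_add, diagonal_mul_diagonal, ← diagonal_one]
  congr 1
  ext i
  exact mul_inv_cancel₀ (h i)

/-- core of Proposition 1: with `J = [[R, X], [X, −R]]` and
`Ñ = blockdiag(N, N)` where `R = Γ⁻¹ D_r Γ⁻ᵀ`, `X = Γ⁻¹ D_x Γ⁻ᵀ` and
`N = 2 Γᵀ D_r (D_r² + D_x²)⁻¹ Γ`, one has `Jᵀ Ñ J = [[2R, 0], [0, 2R]]`;
consequently `½ [p;q]ᵀ Jᵀ Ñ J [p;q] = pᵀRp + qᵀRq` for all `p, q`. -/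
theorem stmt_10 {n : ℕ} (Γ : Matrix (Fin n) (Fin n) ℝ) (hΓ : IsUnit Γ.det)
    (r x : Fin n → ℝ) (hr : ∀ i, 0 < r i) (hrx : ∀ i, 0 < r i ^ 2 + x i ^ 2) :
    let Dr := Matrix.diagonal r
    let Dx := Matrix.diagonal x
    let R := Γ⁻¹ * Dr * (Γ⁻¹)ᵀ
    let X := Γ⁻¹ * Dx * (Γ⁻¹)ᵀ
    let Nm := (2 : ℝ) • (Γᵀ * Dr * (Dr ^ 2 + Dx ^ 2)⁻¹ * Γ)
    let J := Matrix.fromBlocks R X X (-R)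
    let Nt := Matrix.fromBlocks Nm 0 0 Nm
    Jᵀ * Nt * J = Matrix.fromBlocks ((2 : ℝ) • R) 0 0 ((2 : ℝ) • R) ∧
    ∀ p q : Fin n → ℝ,
      (1 / 2 : ℝ) * (Sum.elim p q ⬝ᵥ (Jᵀ * Nt * J) *ᵥ Sum.elim p q) =
        p ⬝ᵥ R *ᵥ p + q ⬝ᵥ R *ᵥ q := by
  intro Dr Dx R X Nm J Nt
  have hNm : Nm = (2 : ℝ) • (Γᵀ * diagonal (fun i => r i * (r i ^ 2 + x i ^ 2)⁻¹) * Γ) := by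
    simp only [Nm, Dr, Dx, inv_diagonal_sq_add_sq r x fun i => (hrx i).ne',
      Matrix.mul_assoc Γᵀ, diagonal_mul_diagonal]
  have hprod (a b : Fin n → ℝ) :
      Γ⁻¹ * diagonal a * (Γ⁻¹)ᵀ * Nm * (Γ⁻¹ * diagonal b * (Γ⁻¹)ᵀ) =
        (2 : ℝ) • (Γ⁻¹ * diagonal (fun i => a i * (r i * (r i ^ 2 + x i ^ 2)⁻¹) * b i) *
          (Γ⁻¹)ᵀ) := by
    rw [hNm, Matrix.mul_smul, Matrix.smul_mul, congr_inv_mul_congr_mul_congr_inv hΓ,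
      diagonal_mul_diagonal, diagonal_mul_diagonal]
  have hsum : R * Nm * R + X * Nm * X = (2 : ℝ) • R := by
    simp only [R, X, Dr, Dx, hprod]
    rw [← smul_add, ← Matrix.add_mul, ← Matrix.mul_add, diagonal_add]
    congr 5
    ext i
    have := (hrx i).ne'
    field_simp
  have hcomm : R * Nm * X = X * Nm * R := by
    simp only [R, X, Dr, Dx, hprod]
    congr 5
    ext i
    ring
  have hRT : Rᵀ = R := transpose_congr_diagonal _ _
  have hXT : Xᵀ = X := transpose_congr_diagonal _ _
  have hJ : Jᵀ * Nt * J = fromBlocks ((2 : ℝ) • R) 0 0 ((2 : ℝ) • R) := by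
    simp only [J, Nt, fromBlocks_transpose, fromBlocks_multiply, transpose_neg, hRT, hXT,
      Matrix.mul_zero, add_zero, zero_add, Matrix.neg_mul, Matrix.mul_neg, neg_neg]
    rw [hsum, hcomm, add_neg_cancel, add_comm (X * Nm * X), hsum]
  refine ⟨hJ, fun p q => ?_⟩
  rw [hJ, fromBlocks_mulVec]
  simp only [Sum.elim_comp_inl, Sum.elim_comp_inr, zero_mulVec, add_zero, zero_add,
    sumElim_dotProduct_sumElim, smul_mulVec, dotProduct_smul, smul_eq_mul]
  ring
end

section
/- Let H be a symmetric positive definite n×n real matrix, K an m×n real matrix with full row rank, C an n×k real matrix, d ∈ ℝ^n, E an m×k real matrix, and b ∈ ℝ^m. Then for every θ ∈ ℝ^k, the linear system in (x, y) ∈ ℝ^n × ℝ^m given by H x + C θ + d + Kᵀ y = 0 and K x = E θ + b has a unique solution, and this solution is affine in θ: y = G θ + w with G = −(K H⁻¹ Kᵀ)⁻¹ (K H⁻¹ C + E) and w = −(K H⁻¹ Kᵀ)⁻¹ (K H⁻¹ d + b), and x = M θ + r with M = −H⁻¹(C + Kᵀ G) and r = −H⁻¹(d + Kᵀ w). -/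
open Matrix

/-- A real matrix of full row rank has injective left multiplication. -/
lemma Matrix.vecMul_injective_of_rank_eq_card {m n : Type*} [Fintype m] [Fintype n]
    {K : Matrix m n ℝ} (hK : K.rank = Fintype.card m) : Function.Injective K.vecMul := by
  rw [Matrix.vecMul_injective_iff, linearIndependent_iff_card_eq_finrank_span,
    Set.finrank, ← Matrix.rank_eq_finrank_span_row, hK]

/-- The Schur complement `K H⁻¹ Kᵀ` of a saddle point system is positive definite. -/
lemma Matrix.PosDef.mul_inv_mul_transpose {m n : Type*} [Fintype m] [Fintype n] [DecidableEq n]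
    {H : Matrix n n ℝ} (hH : H.PosDef) {K : Matrix m n ℝ} (hK : K.rank = Fintype.card m) :
    (K * H⁻¹ * Kᵀ).PosDef := by
  simpa using hH.inv.mul_mul_conjTranspose_same (vecMul_injective_of_rank_eq_card hK)

/-- Block elimination for a saddle point system with invertible `H` and Schur complement. -/
lemma Matrix.saddlePoint_iff {R m n : Type*} [CommRing R] [Fintype m] [DecidableEq m] [Fintype n]
    [DecidableEq n] {H : Matrix n n R} {K : Matrix m n R} (hH : IsUnit H.det)
    (hS : IsUnit (K * H⁻¹ * Kᵀ).det) (c x : n → R) (e y : m → R) :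
    (H *ᵥ x + c + Kᵀ *ᵥ y = 0 ∧ K *ᵥ x = e) ↔
      x = -(H⁻¹ *ᵥ (c + Kᵀ *ᵥ y)) ∧
        y = -((K * H⁻¹ * Kᵀ)⁻¹ *ᵥ ((K * H⁻¹) *ᵥ c + e)) := by
  have hx : H *ᵥ x + c + Kᵀ *ᵥ y = 0 ↔ x = -(H⁻¹ *ᵥ (c + Kᵀ *ᵥ y)) := by
    rw [add_assoc, add_eq_zero_iff_eq_neg]
    constructor <;> intro h
    · rw [← mulVec_neg, ← h, mulVec_mulVec, nonsing_inv_mul _ hH, one_mulVec]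
    · rw [h, mulVec_neg, mulVec_mulVec, mul_nonsing_inv _ hH, one_mulVec]
  rw [hx]
  refine and_congr_right fun h => ?_
  have hKx : K *ᵥ x = -((K * H⁻¹) *ᵥ c + (K * H⁻¹ * Kᵀ) *ᵥ y) := by
    rw [h, mulVec_neg, mulVec_mulVec, mulVec_add, mulVec_mulVec]
  rw [hKx]
  constructor <;> intro h'
  · rw [← h', neg_add_rev, add_comm, neg_add_cancel_right, mulVec_neg, mulVec_mulVec,
      nonsing_inv_mul _ hS, one_mulVec, neg_neg]
  · rw [h', mulVec_neg, mulVec_mulVec, mul_nonsing_inv _ hS, one_mulVec]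
    abel

/-- closed-form affine-in-`θ` solution of the KKT equality subsystem.
For `H` symmetric positive definite and `K` of full row rank, for every `θ` the system
`Hx + Cθ + d + Kᵀy = 0`, `Kx = Eθ + b` has a unique solution `(x, y)`, given by the
affine formulas `y = Gθ + w` and `x = Mθ + r`. -/
theorem stmt_13 {n m k : ℕ} (H : Matrix (Fin n) (Fin n) ℝ) (hH : H.PosDef)
    (K : Matrix (Fin m) (Fin n) ℝ) (hK : K.rank = m)
    (C : Matrix (Fin n) (Fin k) ℝ) (d : Fin n → ℝ)
    (E : Matrix (Fin m) (Fin k) ℝ) (b : Fin m → ℝ) :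
    let G : Matrix (Fin m) (Fin k) ℝ := -((K * H⁻¹ * Kᵀ)⁻¹ * (K * H⁻¹ * C + E))
    let w : Fin m → ℝ := -((K * H⁻¹ * Kᵀ)⁻¹ *ᵥ ((K * H⁻¹) *ᵥ d + b))
    let M : Matrix (Fin n) (Fin k) ℝ := -(H⁻¹ * (C + Kᵀ * G))
    let rr : Fin n → ℝ := -(H⁻¹ *ᵥ (d + Kᵀ *ᵥ w))
    ∀ θ : Fin k → ℝ,
      (H *ᵥ (M *ᵥ θ + rr) + C *ᵥ θ + d + Kᵀ *ᵥ (G *ᵥ θ + w) = 0 ∧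
        K *ᵥ (M *ᵥ θ + rr) = E *ᵥ θ + b) ∧
      (∀ (x : Fin n → ℝ) (y : Fin m → ℝ),
        H *ᵥ x + C *ᵥ θ + d + Kᵀ *ᵥ y = 0 → K *ᵥ x = E *ᵥ θ + b →
        x = M *ᵥ θ + rr ∧ y = G *ᵥ θ + w) := by
  intro G w M rr θ
  have hS := (hH.mul_inv_mul_transpose (K := K) (by simpa using hK)).det_pos.ne'.isUnit
  have key := saddlePoint_iff hH.det_pos.ne'.isUnit hS (C *ᵥ θ + d) (e := E *ᵥ θ + b)
  simp only [← add_assoc] at key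
  have hy : G *ᵥ θ + w =
      -((K * H⁻¹ * Kᵀ)⁻¹ *ᵥ ((K * H⁻¹) *ᵥ (C *ᵥ θ + d) + E *ᵥ θ + b)) := by
    simp only [G, w, neg_mulVec, ← mulVec_mulVec, add_mulVec, mulVec_add]
    abel
  have hx : M *ᵥ θ + rr = -(H⁻¹ *ᵥ (C *ᵥ θ + d + Kᵀ *ᵥ (G *ᵥ θ + w))) := by
    simp only [M, rr, neg_mulVec, ← mulVec_mulVec, add_mulVec, mulVec_add]
    abel
  refine ⟨(key _ _).2 ⟨hx, hy⟩, fun x y h₁ h₂ => ?_⟩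
  obtain ⟨hx', hy'⟩ := (key x y).1 ⟨h₁, h₂⟩
  rw [← hy] at hy'
  rw [hy', ← hx] at hx'
  exact ⟨hx', hy'⟩
end

section
/- Consider the parameterized quadratic program QP(θ): minimize ½ xᵀHx + (Cθ + d)ᵀx over x ∈ ℝ^n subject to A x ≤ E θ + b and B x = F θ + f, where H is symmetric positive definite. Fix a subset of the inequality constraints (the active set), let Ã, Ẽ, b̃ be the corresponding rows of A, E, b, and Ā, Ē, b̄ the remaining rows, and assume K := [Ãᵀ Bᵀ]ᵀ has full row rank. Define [G₁; G₂] := −(K H⁻¹ Kᵀ)⁻¹ (K H⁻¹ C + [Ẽ; F]), [w₁; w₂] := −(K H⁻¹ Kᵀ)⁻¹ (K H⁻¹ d + [b̃; f]), M := −H⁻¹(C + Ãᵀ G₁ + Bᵀ G₂), and r := −H⁻¹(d + Ãᵀ w₁ + Bᵀ w₂). If θ satisfies both Ā(Mθ + r) < Ē θ + b̄ (componentwise strict inequality) and G₁ θ + w₁ ≥ 0 (componentwise), then x = M θ + r is the unique global minimizer of QP(θ), with Ã x = Ẽ θ + b̃ and B x = F θ + f. -/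
open Matrix

/-- The primal point recovered from the multiplier `-(K H⁻¹ Kᵀ)⁻¹ (K H⁻¹ c + e)` satisfies the
equality constraint `K x = e`. -/
lemma Matrix.PosDef.mulVec_lagrange_solution {m n : Type*} [Fintype m] [DecidableEq m]
    [Fintype n] [DecidableEq n] {H : Matrix n n ℝ} (hH : H.PosDef) {K : Matrix m n ℝ}
    (hK : Function.Injective K.vecMul) (c : n → ℝ) (e : m → ℝ) :
    K *ᵥ (-(H⁻¹ *ᵥ (c + Kᵀ *ᵥ (-((K * H⁻¹ * Kᵀ)⁻¹ *ᵥ ((K * H⁻¹) *ᵥ c + e)))))) = e := by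
  have hS : (K * H⁻¹ * Kᵀ).PosDef := by
    simpa using hH.inv.mul_mul_conjTranspose_same hK
  have hdet : IsUnit (K * H⁻¹ * Kᵀ).det := (Matrix.isUnit_iff_isUnit_det _).mp hS.isUnit
  have hcancel (v : m → ℝ) :
      K *ᵥ (H⁻¹ *ᵥ (Kᵀ *ᵥ ((K * H⁻¹ * Kᵀ)⁻¹ *ᵥ v))) = v := by
    rw [mulVec_mulVec, mulVec_mulVec, mulVec_mulVec,
      Matrix.mul_nonsing_inv _ hdet, one_mulVec]
  rw [mulVec_neg, mulVec_add, mulVec_add, mulVec_neg, mulVec_neg, mulVec_neg, hcancel,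
    mulVec_mulVec]
  abel

/-- Sufficiency of the KKT conditions for a strictly convex quadratic program: a point at which
the Lagrangian is stationary, with nonnegative multipliers for the active inequalities, has
strictly smaller cost than every other feasible point. -/
lemma Matrix.PosDef.quadratic_lt_of_kkt {n p q : Type*} [Fintype n] [Fintype p] [Fintype q]
    {H : Matrix n n ℝ} (hH : H.PosDef) {A : Matrix p n ℝ} {B : Matrix q n ℝ}
    {c x y : n → ℝ} {l : p → ℝ} {u : q → ℝ}
    (hstat : H *ᵥ x = -(c + Aᵀ *ᵥ l + Bᵀ *ᵥ u)) (hl : ∀ i, 0 ≤ l i)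
    (hA : ∀ i, (A *ᵥ y) i ≤ (A *ᵥ x) i) (hB : B *ᵥ y = B *ᵥ x) (hne : y ≠ x) :
    (1 / 2 : ℝ) * (x ⬝ᵥ H *ᵥ x) + c ⬝ᵥ x < (1 / 2 : ℝ) * (y ⬝ᵥ H *ᵥ y) + c ⬝ᵥ y := by
  have hpos : 0 < (y - x) ⬝ᵥ H *ᵥ (y - x) := by
    simpa using hH.dotProduct_mulVec_pos (sub_ne_zero.mpr hne)
  have hsymm : x ⬝ᵥ H *ᵥ y = y ⬝ᵥ H *ᵥ x := by
    have hT : Hᵀ = H := by simpa using hH.isHermitian.eq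
    rw [dotProduct_comm, ← vecMul_transpose, hT, dotProduct_mulVec]
  have hgrad (z : n → ℝ) :
      z ⬝ᵥ H *ᵥ x = -(c ⬝ᵥ z + l ⬝ᵥ A *ᵥ z + u ⬝ᵥ B *ᵥ z) := by
    rw [hstat, dotProduct_neg, dotProduct_add, dotProduct_add, mulVec_transpose, mulVec_transpose,
      dotProduct_comm z, dotProduct_comm z, dotProduct_comm z, dotProduct_mulVec,
      dotProduct_mulVec]
  have hcompl : l ⬝ᵥ A *ᵥ y ≤ l ⬝ᵥ A *ᵥ x :=
    Finset.sum_le_sum fun i _ => mul_le_mul_of_nonneg_left (hA i) (hl i)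
  have hx := hgrad x
  have hy := hgrad y
  rw [hB] at hy
  rw [mulVec_sub, sub_dotProduct, dotProduct_sub, dotProduct_sub, hsymm] at hpos
  linarith

/-- critical regions of the multiparametric QP.
For the MPQP `min ½xᵀHx + (Cθ+d)ᵀx s.t. Ax ≤ Eθ+b, Bx = Fθ+f` with `H` symmetric
positive definite, fix an active set of the inequality constraints: `At, Et, bt` are the
active rows (of `A, E, b`) and `Ab, Eb, bb` the remaining (inactive) rows. Assume
`K = [Atᵀ Bᵀ]ᵀ` has full row rank. If `θ` satisfies `Ab(Mθ + r) < Ebθ + bb` (strictly,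
componentwise) and `G₁θ + w₁ ≥ 0` (componentwise), then `x = Mθ + r` is the unique global
minimizer of the QP at `θ`, with `At x = Etθ + bt` and `B x = Fθ + f`. -/
theorem stmt_14 {n ma mi me k : ℕ}
    (H : Matrix (Fin n) (Fin n) ℝ) (hH : H.PosDef)
    (C : Matrix (Fin n) (Fin k) ℝ) (d : Fin n → ℝ)
    (At : Matrix (Fin ma) (Fin n) ℝ) (Et : Matrix (Fin ma) (Fin k) ℝ) (bt : Fin ma → ℝ)
    (Ab : Matrix (Fin mi) (Fin n) ℝ) (Eb : Matrix (Fin mi) (Fin k) ℝ) (bb : Fin mi → ℝ)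
    (B : Matrix (Fin me) (Fin n) ℝ) (F : Matrix (Fin me) (Fin k) ℝ) (f : Fin me → ℝ)
    (hK : (Matrix.fromRows At B).rank = ma + me)
    (θ : Fin k → ℝ) :
    let K := Matrix.fromRows At B
    let GG : Matrix (Fin ma ⊕ Fin me) (Fin k) ℝ :=
      -((K * H⁻¹ * Kᵀ)⁻¹ * (K * H⁻¹ * C + Matrix.fromRows Et F))
    let G₁ := GG.submatrix Sum.inl id
    let G₂ := GG.submatrix Sum.inr id
    let ww : Fin ma ⊕ Fin me → ℝ :=
      -((K * H⁻¹ * Kᵀ)⁻¹ *ᵥ ((K * H⁻¹) *ᵥ d + Sum.elim bt f))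
    let w₁ := ww ∘ Sum.inl
    let w₂ := ww ∘ Sum.inr
    let M : Matrix (Fin n) (Fin k) ℝ := -(H⁻¹ * (C + Atᵀ * G₁ + Bᵀ * G₂))
    let rr : Fin n → ℝ := -(H⁻¹ *ᵥ (d + Atᵀ *ᵥ w₁ + Bᵀ *ᵥ w₂))
    let x := M *ᵥ θ + rr
    (∀ i, (Ab *ᵥ x) i < (Eb *ᵥ θ + bb) i) →
    (∀ i, 0 ≤ (G₁ *ᵥ θ + w₁) i) →
      At *ᵥ x = Et *ᵥ θ + bt ∧
      B *ᵥ x = F *ᵥ θ + f ∧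
      (∀ i, (At *ᵥ x) i ≤ (Et *ᵥ θ + bt) i) ∧
      (∀ i, (Ab *ᵥ x) i ≤ (Eb *ᵥ θ + bb) i) ∧
      (∀ y : Fin n → ℝ,
        (∀ i, (At *ᵥ y) i ≤ (Et *ᵥ θ + bt) i) →
        (∀ i, (Ab *ᵥ y) i ≤ (Eb *ᵥ θ + bb) i) →
        B *ᵥ y = F *ᵥ θ + f → y ≠ x →
        (1 / 2 : ℝ) * (x ⬝ᵥ H *ᵥ x) + (C *ᵥ θ + d) ⬝ᵥ x <
          (1 / 2 : ℝ) * (y ⬝ᵥ H *ᵥ y) + (C *ᵥ θ + d) ⬝ᵥ y) := by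
  intro K GG G₁ G₂ ww w₁ w₂ M rr x hAb hG
  set c : Fin n → ℝ := C *ᵥ θ + d with hc
  set l : Fin ma ⊕ Fin me → ℝ := GG *ᵥ θ + ww with hl
  have hl_eq : l =
      -((K * H⁻¹ * Kᵀ)⁻¹ *ᵥ ((K * H⁻¹) *ᵥ c + Sum.elim (Et *ᵥ θ + bt) (F *ᵥ θ + f))) := by
    have he : Sum.elim (Et *ᵥ θ + bt) (F *ᵥ θ + f) =
        Matrix.fromRows Et F *ᵥ θ + Sum.elim bt f := by
      rw [fromRows_mulVec]
      ext (i | i) <;> rfl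
    rw [he, hl, hc]
    simp only [GG, ww, neg_mulVec, ← mulVec_mulVec, add_mulVec, mulVec_add]
    abel
  have hKl (v : Fin ma ⊕ Fin me → ℝ) :
      Kᵀ *ᵥ v = Atᵀ *ᵥ (v ∘ Sum.inl) + Bᵀ *ᵥ (v ∘ Sum.inr) := by
    rw [transpose_fromRows, fromCols_mulVec]
  have hl₁ : l ∘ Sum.inl = G₁ *ᵥ θ + w₁ := rfl
  have hl₂ : l ∘ Sum.inr = G₂ *ᵥ θ + w₂ := rfl
  have hx : x = -(H⁻¹ *ᵥ (c + Kᵀ *ᵥ l)) := by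
    rw [hKl, hl₁, hl₂, hc]
    simp only [x, M, rr, neg_mulVec, ← mulVec_mulVec, add_mulVec, mulVec_add]
    abel
  have hKx : K *ᵥ x = Sum.elim (Et *ᵥ θ + bt) (F *ᵥ θ + f) := by
    rw [hx, hl_eq]
    exact hH.mulVec_lagrange_solution
      (Matrix.vecMul_injective_of_rank_eq_card (by simpa using hK)) c _
  rw [fromRows_mulVec] at hKx
  have hAt : At *ᵥ x = Et *ᵥ θ + bt := congrArg (· ∘ Sum.inl) hKx
  have hB : B *ᵥ x = F *ᵥ θ + f := congrArg (· ∘ Sum.inr) hKx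
  have hstat : H *ᵥ x = -(c + Atᵀ *ᵥ (G₁ *ᵥ θ + w₁) + Bᵀ *ᵥ (G₂ *ᵥ θ + w₂)) := by
    have hdet : IsUnit H.det := (Matrix.isUnit_iff_isUnit_det _).mp hH.isUnit
    rw [hx, mulVec_neg, mulVec_mulVec, Matrix.mul_nonsing_inv _ hdet, one_mulVec, hKl, hl₁, hl₂,
      ← add_assoc]
  refine ⟨hAt, hB, fun i => (congrFun hAt i).le, fun i => (hAb i).le, fun y hyA _ hyB hne => ?_⟩
  exact hH.quadratic_lt_of_kkt hstat hG (fun i => hAt ▸ hyA i) (hyB.trans hB.symm) hne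
end
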